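/- arXiv:1907.05573 — 2 statements merged into one kernel-verified Lean document; each statement's English description precedes it below -/
import Mathlib

section
/- Let V be a vector space over a field of characteristic zero and let m : V × V → V be a bilinear map satisfying m(x,y) = −m(y,x) for all x, y ∈ V and m(m(x,y),z) = m(m(y,z),x) for all x, y, z ∈ V. Then m(m(m(x,y),z),w) = 0 and m(m(x,y),m(z,w)) = 0 for all x, y, z, w ∈ V; in other words, all products of four elements vanish. -/
/-- Let `V` be a vector space over a field of characteristic zero and let
`m : V × V → V` be a bilinear map satisfying `m(x,y) = −m(y,x)` and
`m(m(x,y),z) = m(m(y,z),x)`.  Then all products of four elements vanish: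
`m(m(m(x,y),z),w) = 0` and `m(m(x,y),m(z,w)) = 0`. -/
theorem comMinus_arity_four_vanishes (K V : Type*) [Field K] [CharZero K]
    [AddCommGroup V] [Module K V]
    (m : V →ₗ[K] V →ₗ[K] V)
    (hskew : ∀ x y : V, m x y = - m y x)
    (hcyc : ∀ x y z : V, m (m x y) z = m (m y z) x) :
    ∀ x y z w : V, m (m (m x y) z) w = 0 ∧ m (m x y) (m z w) = 0 := by
  have swap₁₂ (a b c d : V) : m (m (m a b) c) d = -m (m (m b a) c) d := by
    rw [hskew a b]; simp
  have swap₂₃ (a b c d : V) : m (m (m a b) c) d = -m (m (m a c) b) d := by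
    rw [hcyc a c b, hcyc c b a, hskew b a]; simp
  have swap₃₄ (a b c d : V) : m (m (m a b) c) d = -m (m (m a b) d) c := by
    rw [hcyc (m a b) c d, hcyc c d (m a b), hskew d (m a b)]; simp
  have swap_pairs (a b c d : V) : m (m (m a b) c) d = m (m (m c d) a) b := by
    rw [swap₂₃ a b c d, swap₁₂ a c b d, swap₃₄ c a b d, swap₂₃ c a d b]; simp
  have left_normed_eq_zero (a b c d : V) : m (m (m a b) c) d = 0 := by
    have : IsAddTorsionFree V := .of_isTorsionFree K V
    have h : m (m (m a b) c) d = -m (m (m a b) c) d := by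
      conv_lhs => rw [hcyc (m a b) c d, hskew (m c d), ← hcyc (m c d) a b, ← swap_pairs]
    exact self_eq_neg.mp h
  intro x y z w
  exact ⟨left_normed_eq_zero x y z w, by rw [← hcyc (m z w) x y, left_normed_eq_zero]⟩
end

section
/- Let n = 2k+1. For all S, T ∈ B(k,2k+1), the product ω_S · ω_T in A^k(2k+1) lies in the ℚ-linear span of the set 𝓑(2k+1) consisting of the products ω_{{1}∪I} · ω_J, where I is a k-element subset of {2,…,2k+1}, J is a (k+1)-element subset of {2,…,2k+1}, I ∪ J = {2,…,2k+1}, I ∩ J = {s} is a singleton, and either s = min J or s = max I. In particular 𝓑(2k+1) spans the second graded component of A^k(2k+1). -/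
open FreeAlgebra

/-- Index set for the generators of the generalized Orlik–Solomon algebra:
`(k+1)`-element subsets of `{1,…,n}` (modelled as `Fin n`). -/
abbrev OSGen (k n : ℕ) := {S : Finset (Fin n) // S.card = k + 1}

/-- The defining relations of the (even) generalized Orlik–Solomon algebra `A^k(n)`:
(i) anticommutativity `ω_S ω_T + ω_T ω_S = 0`;
(ii) `ω_S ω_T = 0` whenever `|S ∩ T| ≥ 2`;
(iii) for every injective `i : ℤ/(2k+1) → {1,…,n}` the cyclic sum
`∑_{m} ω_{i({m,…,m+k})} ω_{i({m+k,…,m+2k})} = 0`. -/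
inductive OSRel (k n : ℕ) :
    FreeAlgebra ℚ (OSGen k n) → FreeAlgebra ℚ (OSGen k n) → Prop
  | anticomm (S T : OSGen k n) :
      OSRel k n (ι ℚ S * ι ℚ T + ι ℚ T * ι ℚ S) 0
  | ortho (S T : OSGen k n) (h : 2 ≤ (S.1 ∩ T.1).card) :
      OSRel k n (ι ℚ S * ι ℚ T) 0
  | cyclic (i : ZMod (2 * k + 1) → Fin n) (hi : Function.Injective i)
      (A : ZMod (2 * k + 1) → OSGen k n)
      (hA : ∀ m : ZMod (2 * k + 1),
        (A m).1 = (Finset.range (k + 1)).image fun j : ℕ => i (m + (j : ZMod (2 * k + 1)))) :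
      OSRel k n
        (∑ m : ZMod (2 * k + 1), ι ℚ (A m) * ι ℚ (A (m + (k : ZMod (2 * k + 1))))) 0

/-- The (even) generalized Orlik–Solomon algebra `A^k(n)`. -/
abbrev OSAlg (k n : ℕ) := RingQuot (OSRel k n)

/-- The generator `ω_S` of `A^k(n)`. -/
noncomputable def omegaOS (k n : ℕ) (S : OSGen k n) : OSAlg k n :=
  RingQuot.mkAlgHom ℚ (OSRel k n) (ι ℚ S)

/-- The window `{m, m+1, …, m+k}` in `ℤ/(2k+1)`. -/
def cyclicWindow (k : ℕ) (m : ZMod (2 * k + 1)) : Finset (ZMod (2 * k + 1)) :=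
  (Finset.range (k + 1)).image fun j : ℕ => m + (j : ZMod (2 * k + 1))

lemma mem_cyclicWindow {k : ℕ} {m z : ZMod (2 * k + 1)} :
    z ∈ cyclicWindow k m ↔
      (m.val ≤ z.val ∧ z.val ≤ m.val + k) ∨ z.val + (2 * k + 1) ≤ m.val + k := by
  have hm := ZMod.val_lt m
  have hz := ZMod.val_lt z
  simp only [cyclicWindow, Finset.mem_image, Finset.mem_range]
  constructor
  · rintro ⟨j, hj, rfl⟩
    have hjv : (j : ZMod (2 * k + 1)).val = j := ZMod.val_natCast_of_lt (by omega)
    rcases lt_or_ge (m.val + (j : ZMod (2 * k + 1)).val) (2 * k + 1) with h | h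
    · rw [ZMod.val_add_of_lt h]
      omega
    · have := ZMod.val_add_val_of_le h
      omega
  · rintro (h | h)
    · refine ⟨z.val - m.val, by omega, ?_⟩
      rw [Nat.cast_sub h.1]
      simp
    · refine ⟨z.val + (2 * k + 1) - m.val, by omega, ?_⟩
      rw [Nat.cast_sub (by omega), Nat.cast_add, ZMod.natCast_self]
      simp

lemma card_cyclicWindow (k : ℕ) (m : ZMod (2 * k + 1)) : (cyclicWindow k m).card = k + 1 := by
  rw [cyclicWindow, Finset.card_image_of_injOn, Finset.card_range]
  intro i hi j hj h
  simp only [Finset.coe_range, Set.mem_Iio] at hi hj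
  have h' := congrArg ZMod.val (add_left_cancel h)
  rwa [ZMod.val_natCast_of_lt (by omega), ZMod.val_natCast_of_lt (by omega)] at h'

/-- The generator `ω_X`, extended by `0` to all finite sets `X`. -/
noncomputable def omegaSet (k n : ℕ) (X : Finset (Fin n)) : OSAlg k n :=
  if h : X.card = k + 1 then omegaOS k n ⟨X, h⟩ else 0

lemma omegaSet_of_card {k n : ℕ} {X : Finset (Fin n)} (h : X.card = k + 1) :
    omegaSet k n X = omegaOS k n ⟨X, h⟩ := dif_pos h

lemma omegaOS_eq_omegaSet {k n : ℕ} (S : OSGen k n) : omegaOS k n S = omegaSet k n S.1 :=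
  (omegaSet_of_card S.2).symm

lemma omegaOS_anticomm {k n : ℕ} (S T : OSGen k n) :
    omegaOS k n S * omegaOS k n T = -(omegaOS k n T * omegaOS k n S) := by
  have h := RingQuot.mkAlgHom_rel ℚ (OSRel.anticomm S T)
  rw [map_add, map_mul, map_mul, map_zero] at h
  exact eq_neg_of_add_eq_zero_left h

lemma omegaSet_anticomm (k n : ℕ) (X Y : Finset (Fin n)) :
    omegaSet k n X * omegaSet k n Y = -(omegaSet k n Y * omegaSet k n X) := by
  by_cases hX : X.card = k + 1
  · by_cases hY : Y.card = k + 1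
    · rw [omegaSet_of_card hX, omegaSet_of_card hY]
      exact omegaOS_anticomm _ _
    · simp [omegaSet, hY]
  · simp [omegaSet, hX]

lemma omegaOS_mul_eq_zero {k n : ℕ} {S T : OSGen k n} (h : 2 ≤ (S.1 ∩ T.1).card) :
    omegaOS k n S * omegaOS k n T = 0 := by
  have h := RingQuot.mkAlgHom_rel ℚ (OSRel.ortho S T h)
  rwa [map_mul, map_zero] at h

lemma sum_cyclicWindow_eq_zero {k n : ℕ} (i : ZMod (2 * k + 1) → Fin n)
    (hi : Function.Injective i) :
    ∑ m : ZMod (2 * k + 1), omegaSet k n ((cyclicWindow k m).image i) *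
      omegaSet k n ((cyclicWindow k (m + (k : ZMod (2 * k + 1)))).image i) = 0 := by
  have hc : ∀ m, ((cyclicWindow k m).image i).card = k + 1 := fun m => by
    rw [Finset.card_image_of_injective _ hi, card_cyclicWindow]
  have h := RingQuot.mkAlgHom_rel ℚ (OSRel.cyclic i hi (fun m => ⟨_, hc m⟩)
    (fun m => by simp [cyclicWindow, Finset.image_image, Function.comp_def]))
  rw [map_sum, map_zero] at h
  rw [← h]
  refine Finset.sum_congr rfl fun m _ => ?_
  rw [map_mul, omegaSet_of_card (hc _), omegaSet_of_card (hc _)]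
  rfl

/-- The cyclic arrangement `σ` reads `a, b, C, c, E`, where `C` and `E` have `k - 1` elements. -/
def IsArrangement {k : ℕ} {α : Type*} (σ : ZMod (2 * k + 1) ≃ α) (a b c : α)
    (C E : Finset α) : Prop :=
  ∀ j, (σ j = a ↔ j.val = 0) ∧ (σ j = b ↔ j.val = 1) ∧ (σ j = c ↔ j.val = k + 1) ∧
    (σ j ∈ C ↔ 2 ≤ j.val ∧ j.val ≤ k) ∧ (σ j ∈ E ↔ k + 2 ≤ j.val)

/-- Distinct `a, b, c` lie outside the disjoint sets `C, E` of `k - 1` elements each. -/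
structure IsSplitting {α : Type*} (k : ℕ) (a b c : α) (C E : Finset α) : Prop where
  ab : a ≠ b
  ac : a ≠ c
  bc : b ≠ c
  aC : a ∉ C
  bC : b ∉ C
  cC : c ∉ C
  aE : a ∉ E
  bE : b ∉ E
  cE : c ∉ E
  disj : Disjoint C E
  cardC : C.card + 1 = k
  cardE : E.card + 1 = k

lemma IsSplitting.swap {α : Type*} {k : ℕ} {a b c : α} {C E : Finset α}
    (h : IsSplitting k a b c C E) : IsSplitting k b a c C E :=
  ⟨h.ab.symm, h.bc, h.ac, h.bC, h.aC, h.cC, h.bE, h.aE, h.cE, h.disj, h.cardC, h.cardE⟩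

lemma IsSplitting.rotate {α : Type*} {k : ℕ} {a b c : α} {C E : Finset α}
    (h : IsSplitting k a b c C E) : IsSplitting k b c a C E :=
  ⟨h.bc, h.ab.symm, h.ac.symm, h.bC, h.cC, h.aC, h.bE, h.cE, h.aE, h.disj, h.cardC, h.cardE⟩

lemma card_filter_val_Ico {N p q : ℕ} [NeZero N] (hq : q ≤ N) :
    (Finset.univ.filter fun j : ZMod N => p ≤ j.val ∧ j.val < q).card = q - p := by
  rw [← Nat.card_Ico, ← Finset.card_image_of_injective _ (ZMod.val_injective N)]
  congr 1
  ext x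
  simp only [Finset.mem_image, Finset.mem_filter, Finset.mem_univ, true_and, Finset.mem_Ico]
  constructor
  · rintro ⟨j, hj, rfl⟩
    exact hj
  · intro hx
    have : (x : ZMod N).val = x := ZMod.val_natCast_of_lt (by omega)
    exact ⟨x, by rwa [this], this⟩

lemma exists_equiv_of_card_fiber {α β γ : Type*} [Fintype α] [Fintype β] [DecidableEq γ]
    (f : α → γ) (g : β → γ)
    (h : ∀ c, (Finset.univ.filter fun x => f x = c).card =
      (Finset.univ.filter fun y => g y = c).card) :
    ∃ σ : α ≃ β, ∀ x, g (σ x) = f x := by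
  have e : ∀ c, Nonempty ({x // f x = c} ≃ {y // g y = c}) := fun c =>
    ⟨Fintype.equivOfCardEq (by rw [Fintype.card_subtype, Fintype.card_subtype, h c])⟩
  exact ⟨Equiv.ofFiberEquiv fun c => (e c).some, fun x => Equiv.ofFiberEquiv_map _ x⟩

lemma IsSplitting.exists_isArrangement {k : ℕ} {a b c : Fin (2 * k + 1)}
    {C E : Finset (Fin (2 * k + 1))} (h : IsSplitting k a b c C E) :
    ∃ σ : ZMod (2 * k + 1) ≃ Fin (2 * k + 1), IsArrangement σ a b c C E := by
  obtain ⟨ab, ac, bc, aC, bC, cC, aE, bE, cE, hd, hC, hE⟩ := h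
  have hd' : ∀ x ∈ C, x ∉ E := fun x hx => Finset.disjoint_left.1 hd hx
  have hcov : ∀ y, y = a ∨ y = b ∨ y = c ∨ y ∈ C ∨ y ∈ E := by
    have hcard : (insert a (insert b (insert c (C ∪ E)))).card = 2 * k + 1 := by
      rw [Finset.card_insert_of_notMem, Finset.card_insert_of_notMem,
        Finset.card_insert_of_notMem, Finset.card_union_of_disjoint hd]
      · omega
      all_goals simp [*]
    have huniv := (Finset.card_eq_iff_eq_univ _).1 (hcard.trans (Fintype.card_fin _).symm)
    intro y
    have hy := Finset.mem_univ y
    rw [← huniv] at hy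
    simpa using hy
  let f : ZMod (2 * k + 1) → Fin 5 := fun j =>
    if j.val = 0 then 0 else if j.val = 1 then 1 else if j.val ≤ k then 2 else
    if j.val = k + 1 then 3 else 4
  let g : Fin (2 * k + 1) → Fin 5 := fun y =>
    if y = a then 0 else if y = b then 1 else if y ∈ C then 2 else if y = c then 3 else 4
  have hf : ∀ (x : Fin 5) (p q : ℕ), q ≤ 2 * k + 1 →
      (∀ j, j.val < 2 * k + 1 → (f j = x ↔ p ≤ j.val ∧ j.val < q)) →
      (Finset.univ.filter fun j => f j = x).card = q - p := by
    intro x p q hq hx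
    rw [← card_filter_val_Ico (N := 2 * k + 1) hq]
    congr 1
    ext j
    simp [hx j (ZMod.val_lt j)]
  have hg : ∀ (x : Fin 5) (X : Finset (Fin (2 * k + 1))), (∀ y, g y = x ↔ y ∈ X) →
      (Finset.univ.filter fun y => g y = x).card = X.card := by
    intro x X hX
    congr 1
    ext y
    simp [hX y]
  obtain ⟨σ, hσ⟩ := exists_equiv_of_card_fiber f g (by
    intro x
    fin_cases x
    · rw [hf _ 0 1 (by omega) (by intro j hj; simp only [f]; grind),
        hg _ {a} (by intro y; simp only [g]; grind)]
      simp
    · rw [hf _ 1 2 (by omega) (by intro j hj; simp only [f]; grind),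
        hg _ {b} (by intro y; simp only [g]; grind)]
      simp
    · rw [hf _ 2 (k + 1) (by omega) (by intro j hj; simp only [f]; grind),
        hg _ C (by intro y; simp only [g]; grind)]
      omega
    · rw [hf _ (k + 1) (k + 2) (by omega) (by intro j hj; simp only [f]; grind),
        hg _ {c} (by intro y; simp only [g]; grind)]
      simp
    · rw [hf _ (k + 2) (2 * k + 1) (by omega) (by intro j hj; simp only [f]; grind),
        hg _ E (by intro y; simp only [g]; grind)]
      omega)
  refine ⟨σ, fun j => ?_⟩
  have h1 := hσ j
  have h2 := hcov (σ j)
  have hj := ZMod.val_lt j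
  simp only [f, g] at h1
  refine ⟨?_, ?_, ?_, ?_, ?_⟩ <;> grind

section Arrangement

variable {k : ℕ} {a b c : Fin (2 * k + 1)} {C E : Finset (Fin (2 * k + 1))}
  {σ : ZMod (2 * k + 1) ≃ Fin (2 * k + 1)}

lemma image_eq_of_forall_mem_iff {α β : Type*} [DecidableEq β] (e : α ≃ β) {X : Finset α}
    {Y : Finset β} (h : ∀ j, j ∈ X ↔ e j ∈ Y) : X.image e = Y := by
  ext y
  obtain ⟨j, rfl⟩ := e.surjective y
  rw [h j |>.symm]
  simp

lemma IsArrangement.image_window_zero (h : IsArrangement σ a b c C E)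
    {m : ZMod (2 * k + 1)} (hm : m.val = 0) :
    (cyclicWindow k m).image σ = insert a (insert b C) := by
  refine image_eq_of_forall_mem_iff σ fun j => ?_
  have := ZMod.val_lt j
  simp only [mem_cyclicWindow, Finset.mem_insert, h j]
  omega

lemma IsArrangement.image_window_one (h : IsArrangement σ a b c C E) (hk : 1 ≤ k)
    {m : ZMod (2 * k + 1)} (hm : m.val = 1) :
    (cyclicWindow k m).image σ = insert c (insert b C) := by
  refine image_eq_of_forall_mem_iff σ fun j => ?_
  have := ZMod.val_lt j
  simp only [mem_cyclicWindow, Finset.mem_insert, h j]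
  omega

lemma IsArrangement.image_window_add_one (h : IsArrangement σ a b c C E)
    {m : ZMod (2 * k + 1)} (hm : m.val = k + 1) :
    (cyclicWindow k m).image σ = insert a (insert c E) := by
  refine image_eq_of_forall_mem_iff σ fun j => ?_
  have := ZMod.val_lt j
  simp only [mem_cyclicWindow, Finset.mem_insert, h j]
  omega

lemma IsArrangement.image_window_add_two (h : IsArrangement σ a b c C E)
    {m : ZMod (2 * k + 1)} (hm : m.val = k + 2) :
    (cyclicWindow k m).image σ = insert b (insert a E) := by
  refine image_eq_of_forall_mem_iff σ fun j => ?_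
  have := ZMod.val_lt j
  simp only [mem_cyclicWindow, Finset.mem_insert, h j]
  omega

lemma IsArrangement.swap (h : IsArrangement σ a b c C E) (hs : IsSplitting k a b c C E) :
    IsArrangement (σ.trans (Equiv.swap a b)) b a c C E := by
  obtain ⟨ab, ac, bc, aC, bC, cC, aE, bE, cE, -, -, -⟩ := hs
  intro j
  rw [Equiv.trans_apply, ← (h j).1, ← (h j).2.1, ← (h j).2.2.1, ← (h j).2.2.2.1,
    ← (h j).2.2.2.2]
  rcases eq_or_ne (σ j) a with ha | ha
  · rw [ha, Equiv.swap_apply_left]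
    simp [*, ab.symm]
  · rcases eq_or_ne (σ j) b with hb | hb
    · rw [hb, Equiv.swap_apply_right]
      simp [*, ab.symm]
    · rw [Equiv.swap_apply_of_ne_of_ne ha hb]
      simp [ha, hb]

lemma IsArrangement.image_window_swap (h : IsArrangement σ a b c C E)
    {m : ZMod (2 * k + 1)} (h1 : m.val ≠ 1) (h2 : m.val ≠ k + 1) :
    (cyclicWindow k m).image (σ.trans (Equiv.swap a b)) = (cyclicWindow k m).image σ := by
  refine image_eq_of_forall_mem_iff _ fun j => ?_
  have hm := ZMod.val_lt m
  rw [Equiv.trans_apply]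
  have key : ∀ j, σ j ∈ (cyclicWindow k m).image σ ↔ j ∈ cyclicWindow k m := fun j => by simp
  obtain ⟨i, hi⟩ := σ.surjective (Equiv.swap a b (σ j))
  rw [← hi, key, mem_cyclicWindow, mem_cyclicWindow]
  have hi' := h i
  have hj' := h j
  have := ZMod.val_lt j
  have := ZMod.val_lt i
  rcases eq_or_ne (σ j) a with ha | ha
  · rw [ha, Equiv.swap_apply_left] at hi
    have := hi'.2.1.1 hi
    have := hj'.1.1 ha
    omega
  · rcases eq_or_ne (σ j) b with hb | hb
    · rw [hb, Equiv.swap_apply_right] at hi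
      have := hi'.1.1 hi
      have := hj'.2.1.1 hb
      omega
    · rw [Equiv.swap_apply_of_ne_of_ne ha hb] at hi
      rw [σ.injective hi]

end Arrangement

/-- The product `ω_{{a,c} ∪ E} · ω_{{a,b} ∪ C}`. -/
noncomputable def splitProd (k : ℕ) (a b c : Fin (2 * k + 1)) (C E : Finset (Fin (2 * k + 1))) :
    OSAlg k (2 * k + 1) :=
  omegaSet k _ (insert a (insert c E)) * omegaSet k _ (insert a (insert b C))

lemma val_add_natCast {k : ℕ} (m : ZMod (2 * k + 1)) :
    (m + (k : ZMod (2 * k + 1))).val =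
      if m.val ≤ k then m.val + k else m.val - (k + 1) := by
  have hm := ZMod.val_lt m
  have hk : (k : ZMod (2 * k + 1)).val = k := ZMod.val_natCast_of_lt (by omega)
  split_ifs with h
  · rw [ZMod.val_add_of_lt (by omega), hk]
  · have := ZMod.val_add_val_of_le (a := m) (b := (k : ZMod (2 * k + 1))) (by omega)
    omega

/-- The difference of the cyclic relations of two arrangements that differ by the adjacent
transposition of `a` and `b`. -/
lemma IsSplitting.splitProd_relation {k : ℕ} {a b c : Fin (2 * k + 1)}
    {C E : Finset (Fin (2 * k + 1))} (hs : IsSplitting k a b c C E) (hk : 2 ≤ k) :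
    splitProd k a b c C E + splitProd k b c a C E + splitProd k c a b C E =
      splitProd k b a c C E + splitProd k c b a C E + splitProd k a c b C E := by
  obtain ⟨σ, h⟩ := hs.exists_isArrangement
  have h' := h.swap hs
  have e1 := sum_cyclicWindow_eq_zero σ σ.injective
  have e2 := sum_cyclicWindow_eq_zero _ (σ.trans (Equiv.swap a b)).injective
  have e := (sub_eq_zero.2 (e1.trans e2.symm))
  rw [← Finset.sum_sub_distrib] at e
  have v : ∀ x : ℕ, x < 2 * k + 1 → (x : ZMod (2 * k + 1)).val = x :=
    fun x hx => ZMod.val_natCast_of_lt hx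
  have v1 := v 1 (by omega)
  have v2 := v (k + 1) (by omega)
  have v3 := v (k + 2) (by omega)
  set m1 : ZMod (2 * k + 1) := ((1 : ℕ) : ZMod (2 * k + 1))
  set m2 : ZMod (2 * k + 1) := ((k + 1 : ℕ) : ZMod (2 * k + 1))
  set m3 : ZMod (2 * k + 1) := ((k + 2 : ℕ) : ZMod (2 * k + 1))
  have w1 := val_add_natCast m1
  have w2 := val_add_natCast m2
  have w3 := val_add_natCast m3
  rw [if_pos (by omega), v1] at w1
  rw [if_neg (by omega), v2] at w2
  rw [if_neg (by omega), v3] at w3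
  have n12 : m1 ≠ m2 := fun hh => by rw [hh] at v1; omega
  have n13 : m1 ≠ m3 := fun hh => by rw [hh] at v1; omega
  have n23 : m2 ≠ m3 := fun hh => by rw [hh] at v2; omega
  rw [← Finset.sum_subset (Finset.subset_univ {m1, m2, m3}), Finset.sum_insert (by simp [*]),
    Finset.sum_insert (by simp [*]), Finset.sum_singleton,
    h.image_window_one (by omega) v1, h'.image_window_one (by omega) v1,
    h.image_window_add_one (m := m1 + k) (by omega),
    h'.image_window_add_one (m := m1 + k) (by omega),
    h.image_window_add_one v2, h'.image_window_add_one v2,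
    h.image_window_zero (m := m2 + k) (by omega),
    h'.image_window_zero (m := m2 + k) (by omega),
    h.image_window_add_two v3, h'.image_window_add_two v3,
    h.image_window_one (m := m3 + k) (by omega) (by omega),
    h'.image_window_one (m := m3 + k) (by omega) (by omega),
    omegaSet_anticomm _ _ (insert c (insert b C)), omegaSet_anticomm _ _ (insert c (insert a C))]
    at e
  · simp only [splitProd]
    simp only [Finset.insert_comm a c E, Finset.insert_comm b c E, Finset.insert_comm b a E,
      Finset.insert_comm c b C, Finset.insert_comm c a C, Finset.insert_comm b a C] at e ⊢
    rw [← sub_eq_zero, ← e]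
    abel
  · intro m _ hm
    have q1 : m.val ≠ 1 := fun hh => hm (by simp [ZMod.val_injective _ (hh.trans v1.symm)])
    have q2 : m.val ≠ k + 1 := fun hh => hm (by simp [ZMod.val_injective _ (hh.trans v2.symm)])
    have q3 : m.val ≠ k + 2 := fun hh => hm (by simp [ZMod.val_injective _ (hh.trans v3.symm)])
    have q := val_add_natCast m
    have hlt := ZMod.val_lt m
    rw [h.image_window_swap q1 q2, h.image_window_swap (m := m + k), sub_self]
    · split_ifs at q <;> omega
    · split_ifs at q <;> omega

/-- The set `𝓑(2k+1)`. -/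
def spanningSet (k : ℕ) : Set (OSAlg k (2 * k + 1)) :=
  { x : OSAlg k (2 * k + 1) |
    ∃ (SI SJ : OSGen k (2 * k + 1)) (s : Fin (2 * k + 1)),
      (0 : Fin (2 * k + 1)) ∈ SI.1 ∧
      (0 : Fin (2 * k + 1)) ∉ SJ.1 ∧
      SI.1 ∪ SJ.1 = Finset.univ ∧
      SI.1 ∩ SJ.1 = {s} ∧
      ((∀ y ∈ SJ.1, s ≤ y) ∨ (∀ y ∈ SI.1.erase 0, y ≤ s)) ∧
      x = omegaOS k (2 * k + 1) SI * omegaOS k (2 * k + 1) SJ }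

lemma mul_mem_span_of_min_or_max {k : ℕ} {S T : Finset (Fin (2 * k + 1))} {s : Fin (2 * k + 1)}
    (hS : S.card = k + 1) (hT : T.card = k + 1) (h0S : 0 ∈ S) (h0T : 0 ∉ T) (hST : S ∩ T = {s})
    (h : (∀ y ∈ T, s ≤ y) ∨ ∀ y ∈ S.erase 0, y ≤ s) :
    omegaSet k _ S * omegaSet k _ T ∈ Submodule.span ℚ (spanningSet k) := by
  refine Submodule.subset_span ⟨⟨S, hS⟩, ⟨T, hT⟩, s, h0S, h0T, ?_, hST, h, ?_⟩
  · rw [← Finset.card_eq_iff_eq_univ, Fintype.card_fin]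
    change (S ∪ T).card = _
    have := Finset.card_union_add_card_inter S T
    rw [hST, Finset.card_singleton] at this
    omega
  · rw [omegaSet_of_card hS, omegaSet_of_card hT]

lemma IsSplitting.data {k : ℕ} {a b c : Fin (2 * k + 1)} {C E : Finset (Fin (2 * k + 1))}
    (h : IsSplitting k a b c C E) :
    (insert a (insert c E)).card = k + 1 ∧ (insert a (insert b C)).card = k + 1 ∧
      insert a (insert c E) ∩ insert a (insert b C) = {a} := by
  obtain ⟨ab, ac, bc, aC, bC, cC, aE, bE, cE, hd, hC, hE⟩ := h
  refine ⟨?_, ?_, ?_⟩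
  · rw [Finset.card_insert_of_notMem (by simp [*]), Finset.card_insert_of_notMem cE]
    omega
  · rw [Finset.card_insert_of_notMem (by simp [*]), Finset.card_insert_of_notMem bC]
    omega
  · have hd' : ∀ x ∈ C, x ∉ E := fun x hx => Finset.disjoint_left.1 hd hx
    ext x
    simp only [Finset.mem_inter, Finset.mem_insert, Finset.mem_singleton]
    grind

lemma mul_mem_span_of_inter_eq_singleton {k : ℕ} (d : ℕ) {S T : Finset (Fin (2 * k + 1))}
    {s : Fin (2 * k + 1)} (hS : S.card = k + 1) (hT : T.card = k + 1) (h0S : 0 ∈ S) (h0T : 0 ∉ T)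
    (hST : S ∩ T = {s}) (hd : (T.filter (· < s)).card = d) :
    omegaSet k _ S * omegaSet k _ T ∈ Submodule.span ℚ (spanningSet k) := by
  induction d using Nat.strong_induction_on generalizing S T with
  | _ d ih =>
  by_cases hgood : (∀ y ∈ T, s ≤ y) ∨ ∀ y ∈ S.erase 0, y ≤ s
  · exact mul_mem_span_of_min_or_max hS hT h0S h0T hST hgood
  push Not at hgood
  obtain ⟨⟨t', ht', hts'⟩, i', hi', his'⟩ := hgood
  obtain ⟨t, htT, htmin⟩ := T.exists_min_image id ⟨t', ht'⟩
  obtain ⟨i, hiS, himax⟩ := (S.erase 0).exists_max_image id ⟨i', hi'⟩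
  simp only [id] at htmin himax
  have hts : t < s := (htmin _ ht').trans_lt hts'
  have hsi : s < i := his'.trans_le (himax _ hi')
  have hmem : ∀ x, x ∈ S → x ∈ T → x = s := fun x h1 h2 =>
    Finset.mem_singleton.1 (hST ▸ Finset.mem_inter.2 ⟨h1, h2⟩)
  have hs : s ∈ S ∩ T := hST ▸ Finset.mem_singleton_self s
  obtain ⟨hsS, hsT⟩ := Finset.mem_inter.1 hs
  obtain ⟨hi0, hiS⟩ := Finset.mem_erase.1 hiS
  have htS : t ∉ S := fun h => hts.ne (hmem t h htT)
  have hiT : i ∉ T := fun h => hsi.ne' (hmem i hiS h)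
  have hs0 : s ≠ 0 := fun h => h0T (h ▸ hsT)
  have ht0 : t ≠ 0 := fun h => h0T (h ▸ htT)
  set C := (T.erase s).erase t with hC
  set E := (S.erase s).erase i with hE
  have memC : ∀ x, x ∈ C ↔ x ≠ t ∧ x ≠ s ∧ x ∈ T := by simp [hC]
  have memE : ∀ x, x ∈ E ↔ x ≠ i ∧ x ≠ s ∧ x ∈ S := by simp [hE]
  have hSE : insert s (insert i E) = S := by
    rw [hE, Finset.insert_erase (by simp [hsi.ne', hiS]), Finset.insert_erase hsS]
  have hTC : insert s (insert t C) = T := by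
    rw [hC, Finset.insert_erase (by simp [hts.ne, htT]), Finset.insert_erase hsT]
  have h0E : (0 : Fin (2 * k + 1)) ∈ E := (memE 0).2 ⟨hi0.symm, hs0.symm, h0S⟩
  have h0C : (0 : Fin (2 * k + 1)) ∉ C := fun h => h0T ((memC 0).1 h).2.2
  have cardE : E.card + 1 = k := by
    have h1 := Finset.card_erase_add_one hsS
    have h2 : E.card + 1 = _ := Finset.card_erase_add_one
      (Finset.mem_erase.2 ⟨hsi.ne', hiS⟩)
    omega
  have cardC : C.card + 1 = k := by
    have h1 := Finset.card_erase_add_one hsT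
    have h2 : C.card + 1 = _ := Finset.card_erase_add_one
      (Finset.mem_erase.2 ⟨hts.ne, htT⟩)
    omega
  have hk : 2 ≤ k := by
    have := Finset.card_pos.2 ⟨_, h0E⟩
    omega
  have hsp : IsSplitting k s t i C E :=
    { ab := hts.ne', ac := hsi.ne, bc := (hts.trans hsi).ne
      aC := by simp [memC], bC := by simp [memC], cC := by simp [memC, hiT]
      aE := by simp [memE], bE := by simp [memE, htS], cE := by simp [memE]
      disj := Finset.disjoint_left.2 fun x hx hx' =>
        ((memC x).1 hx).2.1 (hmem x ((memE x).1 hx').2.2 ((memC x).1 hx).2.2)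
      cardC := cardC, cardE := cardE }
  have low : ∀ x ∈ C, t ≤ x := fun x hx => htmin x ((memC x).1 hx).2.2
  have high : ∀ x ∈ E, x ≠ 0 → x ≤ i := fun x hx h0 =>
    himax x (Finset.mem_erase.2 ⟨h0, ((memE x).1 hx).2.2⟩)
  have good : ∀ {a b c : Fin (2 * k + 1)}, IsSplitting k a b c C E → b ≠ 0 → a ≠ 0 →
      ((a ≤ b ∧ ∀ x ∈ C, a ≤ x) ∨ (c ≤ a ∧ ∀ x ∈ E, x ≠ 0 → x ≤ a)) →
      splitProd k a b c C E ∈ Submodule.span ℚ (spanningSet k) := by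
    intro a b c h hb0 ha0 hab
    obtain ⟨h1, h2, h3⟩ := h.data
    refine mul_mem_span_of_min_or_max h1 h2 (by simp [h0E])
      (by simp [h0C, hb0.symm, ha0.symm]) h3 ?_
    refine hab.imp (fun h => ?_) (fun h => ?_)
    · simpa using h
    · intro y hy
      simp only [Finset.mem_erase, Finset.mem_insert] at hy
      rcases hy with ⟨hy0, rfl | rfl | hy⟩
      exacts [le_rfl, h.1, h.2 y hy hy0]
  have g1 := good hsp.swap hs0 ht0 (.inl ⟨hts.le, low⟩)
  have g2 := good hsp.rotate hi0 ht0 (.inl ⟨(hts.trans hsi).le, low⟩)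
  have g3 := good hsp.rotate.swap ht0 hi0 (.inr ⟨hsi.le, high⟩)
  have g4 := good hsp.rotate.rotate hs0 hi0 (.inr ⟨(hts.trans hsi).le, high⟩)
  have hsp' := hsp.rotate.rotate.swap
  have g5 : splitProd k s i t C E ∈ Submodule.span ℚ (spanningSet k) := by
    obtain ⟨h1, h2, h3⟩ := hsp'.data
    refine ih _ ?_ h1 h2 (by simp [h0E]) (by simp [h0C, hi0.symm, hs0.symm]) h3 rfl
    rw [← hd]
    refine Finset.card_lt_card ((Finset.ssubset_iff_of_subset ?_).2 ⟨t, ?_, ?_⟩)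
    · intro x
      simp only [Finset.mem_filter, Finset.mem_insert, memC]
      rintro ⟨rfl | rfl | hx, hlt⟩
      · exact absurd hlt (lt_irrefl _)
      · exact absurd hlt hsi.not_gt
      · exact ⟨hx.2.2, hlt⟩
    · simp [htT, hts]
    · simp [memC, hts.ne, (hts.trans hsi).ne]
  have rel := hsp.splitProd_relation hk
  have main : splitProd k s t i C E = splitProd k t s i C E + splitProd k i t s C E +
      splitProd k s i t C E - splitProd k t i s C E - splitProd k i s t C E := by
    rw [← rel]
    abel
  have := Submodule.sub_mem _ (Submodule.sub_mem _
    (Submodule.add_mem _ (Submodule.add_mem _ g1 g3) g5) g2) g4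
  rw [← main, splitProd, hSE, hTC] at this
  exact this

lemma mul_mem_span_of_zero_notMem_right {k : ℕ} {S T : Finset (Fin (2 * k + 1))}
    (hS : S.card = k + 1) (hT : T.card = k + 1) (h0T : 0 ∉ T) :
    omegaSet k _ S * omegaSet k _ T ∈ Submodule.span ℚ (spanningSet k) := by
  have hui := Finset.card_union_add_card_inter S T
  have hle : (S ∪ T).card ≤ 2 * k + 1 := by simpa using Finset.card_le_univ (S ∪ T)
  by_cases h2 : 2 ≤ (S ∩ T).card
  · rw [omegaSet_of_card hS, omegaSet_of_card hT, omegaOS_mul_eq_zero h2]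
    exact Submodule.zero_mem _
  · have hcard : (S ∩ T).card = 1 := by omega
    obtain ⟨s, hs⟩ := Finset.card_eq_one.1 hcard
    have huniv : S ∪ T = Finset.univ := by
      rw [← Finset.card_eq_iff_eq_univ, Fintype.card_fin]
      omega
    have h0 : (0 : Fin (2 * k + 1)) ∈ S ∪ T := huniv ▸ Finset.mem_univ _
    have h0S := (Finset.mem_union.1 h0).resolve_right h0T
    exact mul_mem_span_of_inter_eq_singleton _ hS hT h0S h0T hs rfl

lemma mul_mem_span_of_zero_notMem {k : ℕ} {S T : Finset (Fin (2 * k + 1))}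
    (hS : S.card = k + 1) (hT : T.card = k + 1) (h0 : 0 ∉ S ∨ 0 ∉ T) :
    omegaSet k _ S * omegaSet k _ T ∈ Submodule.span ℚ (spanningSet k) := by
  rcases h0 with h0 | h0
  · rw [omegaSet_anticomm]
    exact Submodule.neg_mem _ (mul_mem_span_of_zero_notMem_right hT hS h0)
  · exact mul_mem_span_of_zero_notMem_right hS hT h0

lemma IsSplitting.splitProd_zero_mem_span {k : ℕ} {b c : Fin (2 * k + 1)}
    {C E : Finset (Fin (2 * k + 1))} (hk : 1 ≤ k) (hs : IsSplitting k 0 b c C E) :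
    splitProd k 0 b c C E ∈ Submodule.span ℚ (spanningSet k) := by
  obtain ⟨σ, h⟩ := hs.exists_isArrangement
  have e := sum_cyclicWindow_eq_zero σ σ.injective
  have v : ((k + 1 : ℕ) : ZMod (2 * k + 1)).val = k + 1 := ZMod.val_natCast_of_lt (by omega)
  set m0 : ZMod (2 * k + 1) := ((k + 1 : ℕ) : ZMod (2 * k + 1))
  have w := val_add_natCast m0
  rw [if_neg (by omega)] at w
  rw [← Finset.add_sum_erase _ _ (Finset.mem_univ m0), h.image_window_add_one v,
    h.image_window_zero (m := m0 + k) (by omega)] at e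
  rw [splitProd, eq_neg_of_add_eq_zero_left e]
  refine Submodule.neg_mem _ (Submodule.sum_mem _ fun m hm => ?_)
  have hm' : m.val ≠ k + 1 := fun hh =>
    (Finset.mem_erase.1 hm).1 (ZMod.val_injective _ (hh.trans v.symm))
  have hc : ∀ m, ((cyclicWindow k m).image σ).card = k + 1 := fun m => by
    rw [Finset.card_image_of_injective _ σ.injective, card_cyclicWindow]
  have hz : ∀ m, (0 : Fin (2 * k + 1)) ∈ (cyclicWindow k m).image σ ↔
      m.val = 0 ∨ k + 1 ≤ m.val := by
    intro m
    obtain ⟨j, hj⟩ := σ.surjective 0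
    have hj0 := (h j).1.1 hj
    have := ZMod.val_lt m
    rw [← hj, σ.injective.mem_finset_image, mem_cyclicWindow, hj0]
    omega
  refine mul_mem_span_of_zero_notMem (hc _) (hc _) ?_
  rw [hz, hz, val_add_natCast]
  have := ZMod.val_lt m
  split_ifs <;> omega

lemma omegaSet_mul_mem_span {k : ℕ} (hk : 1 ≤ k) {S T : Finset (Fin (2 * k + 1))}
    (hS : S.card = k + 1) (hT : T.card = k + 1) :
    omegaSet k _ S * omegaSet k _ T ∈ Submodule.span ℚ (spanningSet k) := by
  by_cases h0 : 0 ∉ S ∨ 0 ∉ T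
  · exact mul_mem_span_of_zero_notMem hS hT h0
  push Not at h0
  obtain ⟨h0S, h0T⟩ := h0
  by_cases h2 : 2 ≤ (S ∩ T).card
  · rw [omegaSet_of_card hS, omegaSet_of_card hT, omegaOS_mul_eq_zero h2]
    exact Submodule.zero_mem _
  have hmem : ∀ x, x ∈ S → x ∈ T → x = 0 := fun x h1 h3 =>
    Finset.card_le_one.1 (by omega) x (Finset.mem_inter.2 ⟨h1, h3⟩) 0
      (Finset.mem_inter.2 ⟨h0S, h0T⟩)
  have hS' := Finset.card_erase_add_one h0S
  have hT' := Finset.card_erase_add_one h0T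
  obtain ⟨c, hc⟩ := Finset.card_pos.1 (show 0 < (S.erase 0).card by omega)
  obtain ⟨b, hb⟩ := Finset.card_pos.1 (show 0 < (T.erase 0).card by omega)
  have hE := Finset.card_erase_add_one hc
  have hC := Finset.card_erase_add_one hb
  have hSE : insert 0 (insert c ((S.erase 0).erase c)) = S := by
    rw [Finset.insert_erase hc, Finset.insert_erase h0S]
  have hTC : insert 0 (insert b ((T.erase 0).erase b)) = T := by
    rw [Finset.insert_erase hb, Finset.insert_erase h0T]
  rw [Finset.mem_erase] at hb hc
  have hsp : IsSplitting k 0 b c ((T.erase 0).erase b) ((S.erase 0).erase c) :=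
    { ab := hb.1.symm, ac := hc.1.symm
      bc := fun h => hb.1 (hmem b (h ▸ hc.2) hb.2)
      aC := by simp, bC := by simp
      cC := fun h => hc.1 (hmem c hc.2 (by simp at h; exact h.2.2))
      aE := by simp
      bE := fun h => hb.1 (hmem b (by simp at h; exact h.2.2) hb.2)
      cE := by simp
      disj := Finset.disjoint_left.2 fun x hx hx' => by
        simp only [Finset.mem_erase] at hx hx'
        exact hx.2.1 (hmem x hx'.2.2 hx.2.2)
      cardC := by omega
      cardE := by omega }
  have := hsp.splitProd_zero_mem_span hk
  rwa [splitProd, hSE, hTC] at this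

/-- For `n = 2k+1`, every product `ω_S · ω_T` in `A^k(2k+1)` lies in the
`ℚ`-linear span of the set `𝓑(2k+1)` of products `ω_{{1}∪I} · ω_J` where
`I ∪ J = {2,…,2k+1}`, `I ∩ J = {s}` is a singleton, `|{1}∪I| = |J| = k+1`, and either
`s = min J` or `s = max I`.  (The element `1` of `{1,…,2k+1}` is modelled as
`0 : Fin (2k+1)`, the least element.) -/
theorem os_quadratic_spanning_set (k : ℕ) (hk : 1 ≤ k)
    (S T : OSGen k (2 * k + 1)) :
    omegaOS k (2 * k + 1) S * omegaOS k (2 * k + 1) T ∈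
      Submodule.span ℚ
        { x : OSAlg k (2 * k + 1) |
          ∃ (SI SJ : OSGen k (2 * k + 1)) (s : Fin (2 * k + 1)),
            (0 : Fin (2 * k + 1)) ∈ SI.1 ∧
            (0 : Fin (2 * k + 1)) ∉ SJ.1 ∧
            SI.1 ∪ SJ.1 = Finset.univ ∧
            SI.1 ∩ SJ.1 = {s} ∧
            ((∀ y ∈ SJ.1, s ≤ y) ∨ (∀ y ∈ SI.1.erase 0, y ≤ s)) ∧
            x = omegaOS k (2 * k + 1) SI * omegaOS k (2 * k + 1) SJ } := by
  rw [omegaOS_eq_omegaSet, omegaOS_eq_omegaSet]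
  exact omegaSet_mul_mem_span hk S.2 T.2
end
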